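/- Let S = (X_0,…,X_{d−1}) be a d-symbol and ℓ ≥ 1. Let C = C_{(ℓ)}(S) = s_d(s_{dℓ}^{-1}(C(S_{*ℓ}))) be the ℓ-core of S and Q = Q_ℓ(S) = Q(S_{*ℓ}) the balanced ℓ-quotient of S, where S_{*ℓ} = s_{dℓ}(s_d^{-1}(S)). Let δ_{ℓ,S} be the dℓ-hook data tuple with multiplier ℓ whose entry in position sd + i (for s ∈ {0,…,ℓ−1}, i ∈ {0,…,d−1}) is s + ℓ·x_{i,s}, where x_{i,s} is the number of elements of X_i congruent to s modulo ℓ. Then there is a multiset equality 𝓗(S) = abs(𝓗^{δ_{ℓ,S}}(Q)) ∪ 𝓗(C), where 𝓗(T) denotes the multiset of lengths a−b of all hooks of a symbol T, abs(𝓗^{δ_{ℓ,S}}(Q)) is the multiset of absolute values |h^{δ_{ℓ,S}}(z)| over hooks z of Q, and ∪ is multiset union (sum). -/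

import Mathlib

/-- `X^{+s} = (X + s) ∪ {0,…,s−1}` for a β-set `X`. -/
def shiftUp (X : Finset ℕ) (s : ℕ) : Finset ℕ :=
  X.image (· + s) ∪ Finset.range s

/-- The `d`-symbol `s_d(X)` associated to a β-set `X`:
`X_i^{(d)} = {k ∈ ℕ : i + k*d ∈ X}`. -/
def sd (d : ℕ) (X : Finset ℕ) : Fin d → Finset ℕ :=
  fun i => (X.filter fun a => a % d = (i : ℕ)).image fun a => a / d

/-- The inverse of `s_d`, recovering the β-set of a `d`-symbol. -/
def sdInv (d : ℕ) (S : Fin d → Finset ℕ) : Finset ℕ :=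
  Finset.univ.biUnion fun i => (S i).image fun k => (i : ℕ) + k * d

/-- Hooks of a β-set `X`: pairs `(a,b)` with `a > b`, `a ∈ X`, `b ∉ X`. -/
def betaHooks (X : Finset ℕ) : Finset (ℕ × ℕ) :=
  (X ×ˢ Finset.range (X.sup id + 1)).filter fun p => p.2 < p.1 ∧ p.2 ∉ X

/-- Hooks of a `d`-symbol `S`: quadruples `(a,b,i,j)` with `a ∈ S i`, `b ∉ S j`,
and either `a > b`, or `a = b` and `i > j`. -/
def symbolHooks {d : ℕ} (S : Fin d → Finset ℕ) : Finset (ℕ × ℕ × Fin d × Fin d) :=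
  (Finset.range ((Finset.univ.sup fun i => (S i).sup id) + 1) ×ˢ
      Finset.range ((Finset.univ.sup fun i => (S i).sup id) + 1) ×ˢ
      (Finset.univ : Finset (Fin d)) ×ˢ (Finset.univ : Finset (Fin d))).filter
    fun z => z.1 ∈ S z.2.2.1 ∧ z.2.1 ∉ S z.2.2.2 ∧
      (z.2.1 < z.1 ∨ (z.1 = z.2.1 ∧ z.2.2.2 < z.2.2.1))

/-- The partition `p(X)` of a β-set `X = {a_1 > … > a_t}`, as the multiset of the
nonzero numbers among `a_i − (t−i)`; the element `a` contributes the part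
`a − #{b ∈ X : b < a}`. -/
def partitionOf (X : Finset ℕ) : Multiset ℕ :=
  Multiset.filter (· ≠ 0) (X.val.map fun a => a - (X.filter (· < a)).card)

/-- `r`, the maximal number of parts among the partitions `p(X_i)` of a `d`-symbol. -/
def quotCard {d : ℕ} (S : Fin d → Finset ℕ) : ℕ :=
  Finset.univ.sup fun i => Multiset.card (partitionOf (S i))

/-- `Y` is the balanced quotient `Q(S)` of `S`: each `Y i` is the (unique) β-set of
cardinality `r` with `p(Y i) = p(S i)`, where `r` is the maximal number of parts
among the `p(S i)`. -/
def IsBalancedQuotient {d : ℕ} (S Y : Fin d → Finset ℕ) : Prop :=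
  ∀ i, (Y i).card = quotCard S ∧ partitionOf (Y i) = partitionOf (S i)

/-- The core `C(S) = ([x_0],…,[x_{d−1}])` of a `d`-symbol, `x_i = |X_i|`. -/
def coreSymbol {d : ℕ} (S : Fin d → Finset ℕ) : Fin d → Finset ℕ :=
  fun i => Finset.range (S i).card

/-- The `δ`-length `k(a−b) + c_i − c_j` of a hook `(a,b,i,j)`, for the
`d`-hook data tuple `δ = (c_0,…,c_{d−1};k)`. -/
noncomputable def hookLen {d : ℕ} (c : Fin d → ℝ) (k : ℝ)
    (z : ℕ × ℕ × Fin d × Fin d) : ℝ :=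
  k * ((z.1 - z.2.1 : ℕ) : ℝ) + c z.2.2.1 - c z.2.2.2

/-- The multiset `𝓗^δ(S)` of `δ`-lengths of all hooks of `S`. -/
noncomputable def hookLens {d : ℕ} (c : Fin d → ℝ) (k : ℝ)
    (S : Fin d → Finset ℕ) : Multiset ℝ :=
  (symbolHooks S).val.map (hookLen c k)

/-- `H_{ij}^ℓ(S)`, the set of hooks `(a,b,i,j)` of `S` with `a − b = ℓ`. -/
def Hij {d : ℕ} (S : Fin d → Finset ℕ) (i j : Fin d) (ℓ : ℕ) :
    Finset (ℕ × ℕ × Fin d × Fin d) :=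
  (symbolHooks S).filter fun z => z.2.2.1 = i ∧ z.2.2.2 = j ∧ z.1 - z.2.1 = ℓ

/-- The sign-modified length `h̄^{δ_S}` (on hooks of the balanced quotient), where
`x` records the cardinalities `x_i = |X_i|` of `S`, and `δ_S = (c_i + x_i k; k)`.
For a hook `z = (a,b,u,v)` with `ℓ = a − b`: relabelling so that `Δ = x_i − x_j ≥ 0`,
the sign is `+` if `z` lies in position `(i,j)`, or in position `(j,i)` with `ℓ > Δ`,
or in position `(j,i)` with `ℓ = Δ` and `i < j`; otherwise the sign is `−`. -/
noncomputable def signedLen {d : ℕ} (x : Fin d → ℕ) (c : Fin d → ℝ) (k : ℝ)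
    (z : ℕ × ℕ × Fin d × Fin d) : ℝ :=
  if x z.2.2.2 ≤ x z.2.2.1 then
    k * ((z.1 - z.2.1 : ℕ) : ℝ) + (c z.2.2.1 + (x z.2.2.1 : ℝ) * k)
      - (c z.2.2.2 + (x z.2.2.2 : ℝ) * k)
  else if x z.2.2.2 - x z.2.2.1 < z.1 - z.2.1 ∨
      (z.1 - z.2.1 = x z.2.2.2 - x z.2.2.1 ∧ (z.2.2.2 : ℕ) < (z.2.2.1 : ℕ)) then
    k * ((z.1 - z.2.1 : ℕ) : ℝ) + (c z.2.2.1 + (x z.2.2.1 : ℝ) * k)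
      - (c z.2.2.2 + (x z.2.2.2 : ℝ) * k)
  else
    -(k * ((z.1 - z.2.1 : ℕ) : ℝ) + (c z.2.2.1 + (x z.2.2.1 : ℝ) * k)
      - (c z.2.2.2 + (x z.2.2.2 : ℝ) * k))

/-- The permutation `σ_{d,ℓ,e}` of `ℕ`:
`σ(r(dℓ) + sd + t) = r(dℓ) + sd + ((t + re) mod d)`. -/
def twistFun (d ℓ e : ℕ) (n : ℕ) : ℕ :=
  d * ℓ * (n / (d * ℓ)) + d * (n % (d * ℓ) / d) + (n % d + n / (d * ℓ) * e) % d

/-- The Maya diagram of a β-set: the β-set together with all negative integers. -/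
def maya (X : Finset ℕ) : Set ℤ := {n | n < 0 ∨ n.toNat ∈ X}

/-- The number of pairs of a bead of `X` and a gap of `Y` at signed distance `D`
in the Maya diagrams. -/
noncomputable def gapCount (X Y : Finset ℕ) (D : ℤ) : ℕ :=
  {b : ℤ | b + D ∈ maya X ∧ b ∉ maya Y}.ncard

/-- The Maya diagram of `X` moved down by `D` and cut off below `-M`. -/
noncomputable def mayaWindow (X : Finset ℕ) (M D : ℤ) : Finset ℤ :=
  Finset.Ico (-M) (-D) ∪ X.image fun a : ℕ => (a : ℤ) - D

theorem mem_mayaWindow {X : Finset ℕ} {M D : ℤ} (h : D ≤ M) {b : ℤ} :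
    b ∈ mayaWindow X M D ↔ -M ≤ b ∧ b + D ∈ maya X := by
  simp only [mayaWindow, maya, Finset.mem_union, Finset.mem_Ico, Finset.mem_image,
    Set.mem_ofPred_eq]
  constructor
  · rintro (hb | ⟨a, ha, rfl⟩)
    · exact ⟨hb.1, Or.inl (by omega)⟩
    · exact ⟨by omega, Or.inr (by simpa using ha)⟩
  · rintro ⟨hM, hb⟩
    by_cases hneg : b + D < 0
    · exact Or.inl (by omega)
    · exact Or.inr ⟨(b + D).toNat, hb.resolve_left hneg, by omega⟩

theorem card_mayaWindow {X : Finset ℕ} {M D : ℤ} (h : D ≤ M) :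
    ((mayaWindow X M D).card : ℤ) = M - D + X.card := by
  have hdisj : Disjoint (Finset.Ico (-M) (-D)) (X.image fun a : ℕ => (a : ℤ) - D) := by
    rw [Finset.disjoint_left]
    intro b hb hb'
    simp only [Finset.mem_Ico, Finset.mem_image] at hb hb'
    obtain ⟨a, -, rfl⟩ := hb'
    omega
  rw [mayaWindow, Finset.card_union_of_disjoint hdisj, Int.card_Ico,
    Finset.card_image_of_injective _ (fun a b hab => by simpa using hab)]
  omega

theorem gapCount_sub_gapCount (X Y : Finset ℕ) (D : ℤ) :
    (gapCount X Y D : ℤ) - gapCount Y X (-D) = X.card - Y.card - D := by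
  have hD : D ≤ |D| := le_abs_self D
  have hD' : -D ≤ |D| := neg_le_abs D
  have h0 : (0 : ℤ) ≤ |D| := abs_nonneg D
  have h1 : gapCount X Y D = (mayaWindow X |D| D \ mayaWindow Y |D| 0).card := by
    rw [gapCount, ← Set.ncard_coe_finset]
    congr 1
    ext b
    simp only [Finset.coe_sdiff, Set.mem_sdiff, Finset.mem_coe, mem_mayaWindow hD,
      mem_mayaWindow h0, add_zero, Set.mem_ofPred_eq]
    constructor
    · rintro ⟨hX, hY⟩
      have : 0 ≤ b := by simp only [maya, Set.mem_ofPred_eq] at hY; omega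
      exact ⟨⟨by omega, hX⟩, fun h => hY h.2⟩
    · rintro ⟨⟨hM, hX⟩, hY⟩
      exact ⟨hX, fun h => hY ⟨hM, h⟩⟩
  have h2 : gapCount Y X (-D) = (mayaWindow Y |D| 0 \ mayaWindow X |D| D).card := by
    rw [gapCount, ← Set.ncard_coe_finset,
      ← Set.ncard_image_of_injective _ (sub_left_injective (b := D))]
    congr 1
    ext b
    simp only [Finset.coe_sdiff, Set.mem_sdiff, Finset.mem_coe, mem_mayaWindow hD,
      mem_mayaWindow h0, add_zero, Set.mem_ofPred_eq, Set.mem_image]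
    constructor
    · rintro ⟨b, ⟨hY, hX⟩, rfl⟩
      have : 0 ≤ b := by simp only [maya, Set.mem_ofPred_eq] at hX; omega
      exact ⟨⟨by omega, by simpa [sub_eq_add_neg] using hY⟩, fun h => hX (by simpa using h.2)⟩
    · rintro ⟨⟨hM, hY⟩, hX⟩
      exact ⟨b + D, ⟨by simpa using hY, fun h => hX ⟨hM, h⟩⟩, by ring⟩
  have hX := card_mayaWindow (X := X) hD
  have hY := card_mayaWindow (X := Y) h0
  have e1 := Finset.card_sdiff_add_card_inter (mayaWindow X |D| D) (mayaWindow Y |D| 0)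
  have e2 := Finset.card_sdiff_add_card_inter (mayaWindow Y |D| 0) (mayaWindow X |D| D)
  rw [Finset.inter_comm] at e2
  rw [h1, h2]
  omega

theorem gapCount_range (x y : ℕ) (D : ℤ) :
    gapCount (Finset.range x) (Finset.range y) D = ((x : ℤ) - y - D).toNat := by
  have : {b : ℤ | b + D ∈ maya (Finset.range x) ∧ b ∉ maya (Finset.range y)} =
      (Finset.Ico (y : ℤ) (x - D) : Set ℤ) := by
    ext b
    simp only [maya, Finset.mem_range, Set.mem_ofPred_eq, Finset.coe_Ico, Set.mem_Ico]
    omega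
  rw [gapCount, this, Set.ncard_coe_finset, Int.card_Ico]
  congr 1
  ring

theorem gapCount_of_shift {X X' Y Y' : Finset ℕ} {s t : ℤ}
    (hX : ∀ n, n ∈ maya Y ↔ n + s ∈ maya X) (hX' : ∀ n, n ∈ maya Y' ↔ n + t ∈ maya X')
    (D : ℤ) : gapCount Y Y' D = gapCount X X' (D + s - t) := by
  rw [gapCount, gapCount, ← Set.ncard_image_of_injective _ (add_left_injective t)]
  congr 1
  ext b
  simp only [Set.mem_image, Set.mem_ofPred_eq, hX, hX']
  constructor
  · rintro ⟨b, ⟨h1, h2⟩, rfl⟩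
    exact ⟨by convert h1 using 1; ring, h2⟩
  · rintro ⟨h1, h2⟩
    exact ⟨b - t, ⟨by convert h1 using 1; ring, by simpa using h2⟩, by ring⟩

theorem mem_maya_shiftUp (X : Finset ℕ) (s : ℕ) (n : ℤ) :
    n ∈ maya (shiftUp X s) ↔ n - s ∈ maya X := by
  simp only [maya, shiftUp, Finset.mem_union, Finset.mem_image, Finset.mem_range,
    Set.mem_ofPred_eq]
  constructor
  · rintro (h | ⟨a, ha, h⟩ | h)
    · omega
    · right
      convert ha using 1
      omega
    · omega
  · intro h
    by_cases hn : n < s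
    · omega
    · right; left
      exact ⟨_, h.resolve_left (by omega), by omega⟩

/-- The parts of `p(X)` padded with zeros to length `|X|`. -/
def paddedPartition (X : Finset ℕ) : Multiset ℕ :=
  X.val.map fun a => a - (X.filter (· < a)).card

theorem paddedPartition_shiftUp (X : Finset ℕ) (s : ℕ) :
    paddedPartition (shiftUp X s) = paddedPartition X + Multiset.replicate s 0 := by
  have hdisj : Disjoint (X.image (· + s)) (Finset.range s) := by
    rw [Finset.disjoint_left]
    intro b hb hb'
    simp only [Finset.mem_image, Finset.mem_range] at hb hb'
    omega
  have hcard (a : ℕ) : ((shiftUp X s).filter (· < a)).card =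
      (X.filter (· + s < a)).card + min a s := by
    rw [shiftUp, Finset.filter_union, Finset.card_union_of_disjoint
      (Finset.disjoint_filter_filter hdisj), Finset.filter_image,
      Finset.card_image_of_injective _ (add_left_injective s)]
    congr 1
    rw [← Finset.card_range (min a s)]
    congr 1
    ext
    simp only [Finset.mem_filter, Finset.mem_range]
    omega
  have hval : (shiftUp X s).val = X.val.map (· + s) + (Finset.range s).val := by
    rw [shiftUp, ← Finset.disjUnion_eq_union _ _ hdisj, Finset.disjUnion_val,
      Finset.image_val_of_injOn (add_left_injective s).injOn]
  simp only [paddedPartition, hcard]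
  rw [hval, Multiset.map_add, Multiset.map_map]
  congr 1
  · refine Multiset.map_congr rfl fun a _ => ?_
    simp only [Function.comp_apply, add_lt_add_iff_right]
    omega
  · rw [Multiset.eq_replicate]
    refine ⟨by simp, fun b hb => ?_⟩
    simp only [Multiset.mem_map, Finset.range_val, Multiset.mem_range] at hb
    omega

theorem paddedPartition_insert {X : Finset ℕ} {a : ℕ} (h : ∀ x ∈ X, x < a) :
    paddedPartition (insert a X) = (a - X.card) ::ₘ paddedPartition X := by
  have ha : a ∉ X := fun haX => lt_irrefl _ (h a haX)
  rw [paddedPartition, Finset.insert_val_of_notMem ha, Multiset.map_cons]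
  congr 1
  · rw [Finset.filter_insert, if_neg (lt_irrefl a), Finset.filter_true_of_mem h]
  · refine Multiset.map_congr rfl fun b hb => ?_
    rw [Finset.filter_insert, if_neg (h b hb).not_gt]

theorem le_of_mem_paddedPartition {X : Finset ℕ} {a : ℕ} (h : ∀ x ∈ X, x < a) {v : ℕ}
    (hv : v ∈ paddedPartition X) : v ≤ a - X.card := by
  obtain ⟨c, hc, rfl⟩ := Multiset.mem_map.1 hv
  have hsub : X ⊆ X.filter (· < c) ∪ Finset.Ico c a := fun x hx => by
    have := h x hx
    simp only [Finset.mem_union, Finset.mem_filter, Finset.mem_Ico]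
    by_cases hxc : x < c
    · exact Or.inl ⟨hx, hxc⟩
    · exact Or.inr (by omega)
  have h1 := (Finset.card_le_card hsub).trans (Finset.card_union_le _ _)
  have h2 : (X.filter (· < c)).card ≤ c := by
    have : X.filter (· < c) ⊆ Finset.range c := fun x hx => by
      simpa using (Finset.mem_filter.1 hx).2
    simpa using Finset.card_le_card this
  have := h c hc
  rw [Nat.card_Ico] at h1
  omega

theorem paddedPartition_injective : Function.Injective paddedPartition := by
  intro X
  induction X using Finset.induction_on_max with
  | empty =>
    intro Y h
    have := congrArg Multiset.card h
    simpa [paddedPartition, eq_comm] using this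
  | insert a X hX ih =>
    intro Y h
    induction Y using Finset.induction_on_max with
    | empty =>
      rw [paddedPartition_insert hX] at h
      simp [paddedPartition] at h
    | insert b Y hY _ =>
      rw [paddedPartition_insert hX, paddedPartition_insert hY] at h
      have hcard : X.card = Y.card := by
        simpa [paddedPartition] using congrArg Multiset.card h
      have hle {X : Finset ℕ} {a : ℕ} (hX : ∀ x ∈ X, x < a) : X.card ≤ a := by
        have : X ⊆ Finset.range a := fun x hx => by simpa using hX x hx
        simpa using Finset.card_le_card this
      have hXa := hle hX
      have hYb := hle hY
      have h1 : a - X.card ≤ b - Y.card := by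
        have : a - X.card ∈ (b - Y.card) ::ₘ paddedPartition Y := h ▸ Multiset.mem_cons_self _ _
        rcases Multiset.mem_cons.1 this with h | h
        · exact h.le
        · exact le_of_mem_paddedPartition hY h
      have h2 : b - Y.card ≤ a - X.card := by
        have : b - Y.card ∈ (a - X.card) ::ₘ paddedPartition X := h ▸ Multiset.mem_cons_self _ _
        rcases Multiset.mem_cons.1 this with h | h
        · exact h.le
        · exact le_of_mem_paddedPartition hX h
      have hab : a = b := by omega
      subst hab
      rw [hcard] at h
      rw [ih ((Multiset.cons_inj_right _).1 h)]

theorem eq_shiftUp_of_partitionOf_eq {X Y : Finset ℕ} (h : partitionOf Y = partitionOf X)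
    (hle : X.card ≤ Y.card) : Y = shiftUp X (Y.card - X.card) := by
  have hpad (Z : Finset ℕ) : ∃ t, paddedPartition Z = partitionOf Z + Multiset.replicate t 0 := by
    refine ⟨Multiset.count 0 (paddedPartition Z), ?_⟩
    rw [← Multiset.filter_eq', partitionOf, ← paddedPartition]
    simpa using (Multiset.filter_add_not (· ≠ 0) (paddedPartition Z)).symm
  obtain ⟨t, ht⟩ := hpad X
  obtain ⟨u, hu⟩ := hpad Y
  have hXc : X.card = Multiset.card (partitionOf X) + t := by
    simpa [paddedPartition] using congrArg Multiset.card ht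
  have hYc : Y.card = Multiset.card (partitionOf Y) + u := by
    simpa [paddedPartition] using congrArg Multiset.card hu
  apply paddedPartition_injective
  rw [paddedPartition_shiftUp, ht, hu, h, add_assoc, ← Multiset.replicate_add]
  rw [h] at hYc
  congr 2
  omega

theorem mem_maya_iff_of_partitionOf_eq {X Y : Finset ℕ} (h : partitionOf Y = partitionOf X)
    (n : ℤ) : n ∈ maya Y ↔ n + (X.card - Y.card) ∈ maya X := by
  rcases le_total X.card Y.card with hle | hle
  · conv_lhs => rw [eq_shiftUp_of_partitionOf_eq h hle, mem_maya_shiftUp]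
    rw [show n - ((Y.card - X.card : ℕ) : ℤ) = n + (X.card - Y.card) by omega]
  · conv_rhs =>
      rw [eq_shiftUp_of_partitionOf_eq h.symm hle, mem_maya_shiftUp,
        ← eq_shiftUp_of_partitionOf_eq h.symm hle]
    rw [show n + (X.card - Y.card) - ((X.card - Y.card : ℕ) : ℤ) = n by omega]

theorem mem_symbolHooks {d : ℕ} {S : Fin d → Finset ℕ} {z : ℕ × ℕ × Fin d × Fin d} :
    z ∈ symbolHooks S ↔ z.1 ∈ S z.2.2.1 ∧ z.2.1 ∉ S z.2.2.2 ∧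
      (z.2.1 < z.1 ∨ (z.1 = z.2.1 ∧ z.2.2.2 < z.2.2.1)) := by
  simp only [symbolHooks, Finset.mem_filter, Finset.mem_product, Finset.mem_range,
    Finset.mem_univ, and_true, and_iff_right_iff_imp]
  rintro ⟨ha, -, hlt⟩
  have h1 : z.1 ≤ (S z.2.2.1).sup id := Finset.le_sup (f := id) ha
  have h2 : (S z.2.2.1).sup id ≤ Finset.univ.sup fun i => (S i).sup id :=
    Finset.le_sup (f := fun i => (S i).sup id) (Finset.mem_univ _)
  omega

/-- The positions `(D, i, j)` in which a hook of a symbol can lie. -/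
def IsHookPosition {d : ℕ} (p : ℤ × Fin d × Fin d) : Prop :=
  0 < p.1 ∨ (p.1 = 0 ∧ p.2.2 < p.2.1)

/-- The position of a hook: its length together with its two rows. -/
def hookPosition {d : ℕ} (z : ℕ × ℕ × Fin d × Fin d) : ℤ × Fin d × Fin d :=
  ((z.1 : ℤ) - z.2.1, z.2.2)

open Classical in
/-- The number of hooks of `S` in position `p`. -/
noncomputable def hookCount {d : ℕ} (S : Fin d → Finset ℕ) (p : ℤ × Fin d × Fin d) : ℕ :=
  if IsHookPosition p then gapCount (S p.2.1) (S p.2.2) p.1 else 0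

theorem card_filter_hookPosition {d : ℕ} (S : Fin d → Finset ℕ) (p : ℤ × Fin d × Fin d) :
    ((symbolHooks S).filter (hookPosition · = p)).card = hookCount S p := by
  obtain ⟨D, i, j⟩ := p
  rw [hookCount]
  split_ifs with hp
  · simp only [IsHookPosition] at hp
    rw [gapCount, ← Set.ncard_coe_finset]
    refine Set.ncard_congr (fun z _ => (z.2.1 : ℤ)) ?_ ?_ ?_
    · rintro ⟨a, b, u, v⟩ hz
      simp only [Finset.coe_filter, mem_symbolHooks, hookPosition, Prod.mk.injEq,
        Set.mem_ofPred_eq] at hz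
      obtain ⟨⟨ha, hb, -⟩, rfl, rfl, rfl⟩ := hz
      simp [maya, ha, hb]
    · rintro ⟨a, b, u, v⟩ ⟨a', b', u', v'⟩ hz hz' hbb
      simp only [Finset.coe_filter, hookPosition, Prod.mk.injEq, Set.mem_ofPred_eq] at hz hz' hbb
      obtain ⟨-, h1, rfl, rfl⟩ := hz
      obtain ⟨-, h2, rfl, rfl⟩ := hz'
      simp only [Prod.mk.injEq, and_true]
      omega
    · intro b hb
      simp only [maya, Set.mem_ofPred_eq, not_or, not_lt] at hb
      obtain ⟨ha, hb0, hb⟩ := hb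
      refine ⟨((b + D).toNat, b.toNat, i, j), ?_, by simpa using hb0⟩
      simp only [Finset.coe_filter, mem_symbolHooks, hookPosition, Prod.mk.injEq,
        Set.mem_ofPred_eq, and_true]
      exact ⟨⟨ha.resolve_left (by omega), hb, by omega⟩, by omega⟩
  · rw [Finset.card_eq_zero, Finset.filter_eq_empty_iff]
    rintro ⟨a, b, u, v⟩ hz hpos
    rw [mem_symbolHooks] at hz
    apply hp
    rw [← hpos]
    simp only [IsHookPosition, hookPosition] at hz ⊢
    omega

theorem support_hookCount_subset {d : ℕ} (S : Fin d → Finset ℕ) :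
    Function.support (hookCount S) ⊆ ((symbolHooks S).image hookPosition : Finset _) := by
  intro p hp
  rw [Function.mem_support, ← card_filter_hookPosition, Finset.card_ne_zero] at hp
  obtain ⟨z, hz⟩ := hp
  rw [Finset.mem_filter] at hz
  exact Finset.mem_coe.2 (Finset.mem_image.2 ⟨z, hz⟩)

theorem map_hookPosition_symbolHooks {d : ℕ} (S : Fin d → Finset ℕ) {α : Type*}
    (φ : ℤ × Fin d × Fin d → α) :
    (symbolHooks S).val.map (fun z => φ (hookPosition z)) =
      ∑ᶠ p, hookCount S p • ({φ p} : Multiset α) := by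
  have h : Function.support (fun p => hookCount S p • ({φ p} : Multiset α)) ⊆
      ((symbolHooks S).image hookPosition : Finset _) := fun p hp =>
    support_hookCount_subset S fun h0 => hp (by simp [h0])
  rw [finsum_eq_sum_of_support_subset _ h]
  simp only [← card_filter_hookPosition]
  rw [← Finset.sum_comp (fun p => ({φ p} : Multiset α)), Finset.sum_eq_multiset_sum]
  conv_lhs => rw [← Multiset.sum_map_singleton (Multiset.map _ _), Multiset.map_map]
  rfl

/-- The length attached to a position by a hook data tuple. -/
noncomputable def positionLen {d : ℕ} (c : Fin d → ℝ) (k : ℝ) (p : ℤ × Fin d × Fin d) : ℝ :=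
  k * p.1 + c p.2.1 - c p.2.2

theorem hookLens_eq_map_positionLen {d : ℕ} (c : Fin d → ℝ) (k : ℝ) (S : Fin d → Finset ℕ) :
    hookLens c k S = (symbolHooks S).val.map (fun z => positionLen c k (hookPosition z)) := by
  refine Multiset.map_congr rfl fun z hz => ?_
  have hz' := mem_symbolHooks.1 hz
  have hle : z.2.1 ≤ z.1 := by omega
  simp [hookLen, positionLen, hookPosition, Nat.cast_sub hle]

/-- Exchanging the two ends of a position. -/
def flipPosition (d : ℕ) : (ℤ × Fin d × Fin d) ≃ (ℤ × Fin d × Fin d) where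
  toFun p := (-p.1, p.2.2, p.2.1)
  invFun p := (-p.1, p.2.2, p.2.1)
  left_inv p := by simp
  right_inv p := by simp

/-- Moving row `i` of a symbol by `x i`. -/
def shiftPosition {d : ℕ} (x : Fin d → ℤ) : (ℤ × Fin d × Fin d) ≃ (ℤ × Fin d × Fin d) where
  toFun p := (p.1 + x p.2.1 - x p.2.2, p.2)
  invFun p := (p.1 - x p.2.1 + x p.2.2, p.2)
  left_inv p := Prod.ext (by dsimp only; ring) rfl
  right_inv p := Prod.ext (by dsimp only; ring) rfl

section Counting

variable {d : ℕ} {T Y : Fin d → Finset ℕ} {r : ℕ}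

theorem gapCount_eq_gapCount_shiftPosition (hcard : ∀ i, (Y i).card = r)
    (hY : ∀ i, partitionOf (Y i) = partitionOf (T i)) (p : ℤ × Fin d × Fin d) :
    gapCount (Y p.2.1) (Y p.2.2) p.1 = gapCount (T p.2.1) (T p.2.2)
      (shiftPosition (fun i => ((T i).card : ℤ)) p).1 := by
  rw [gapCount_of_shift (mem_maya_iff_of_partitionOf_eq (hY p.2.1))
    (mem_maya_iff_of_partitionOf_eq (hY p.2.2)), hcard, hcard]
  congr 1
  simp only [shiftPosition, Equiv.coe_fn_mk]
  ring

open Classical in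
/-- The hooks of `T` are, position by position, those hooks of `Y` that stay hooks after
shifting the rows, those that are turned into hooks by an exchange of their ends,
and the hooks of the core. -/
theorem hookCount_eq_add (hcard : ∀ i, (Y i).card = r)
    (hY : ∀ i, partitionOf (Y i) = partitionOf (T i)) (q : ℤ × Fin d × Fin d) :
    hookCount T q =
      (if IsHookPosition q then
        hookCount Y ((shiftPosition fun i => ((T i).card : ℤ)).symm q) else 0) +
      (if IsHookPosition q then
        hookCount Y ((shiftPosition fun i => ((T i).card : ℤ)).symm (flipPosition d q)) else 0) +
      hookCount (coreSymbol T) q := by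
  by_cases hq : IsHookPosition q
  · have h1 := gapCount_sub_gapCount (T q.2.1) (T q.2.2) q.1
    simp only [hookCount, hq, if_true, gapCount_eq_gapCount_shiftPosition hcard hY,
      Equiv.apply_symm_apply, coreSymbol, gapCount_range]
    by_cases hA : IsHookPosition ((shiftPosition fun i => ((T i).card : ℤ)).symm q) <;>
    by_cases hB : IsHookPosition
      ((shiftPosition fun i => ((T i).card : ℤ)).symm (flipPosition d q)) <;>
    simp only [hA, hB, if_true, if_false] <;>
    obtain ⟨D, i, j⟩ := q <;>
    simp only [IsHookPosition, shiftPosition, flipPosition, Equiv.coe_fn_symm_mk,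
      Equiv.coe_fn_mk] at * <;>
    rcases lt_trichotomy i j with hij | rfl | hij <;>
    omega
  · simp [hookCount, hq]

theorem not_isHookPosition_flip {p : ℤ × Fin d × Fin d} (hp : IsHookPosition p) :
    ¬ IsHookPosition (flipPosition d p) := by
  simp only [IsHookPosition, flipPosition, Equiv.coe_fn_mk] at *
  omega

theorem isHookPosition_or_flip {x : Fin d → ℤ} {p : ℤ × Fin d × Fin d} (hp : IsHookPosition p) :
    IsHookPosition (shiftPosition x p) ∨
      IsHookPosition (flipPosition d (shiftPosition x p)) := by
  obtain ⟨D, i, j⟩ := p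
  simp only [IsHookPosition, flipPosition, shiftPosition, Equiv.coe_fn_mk] at *
  rcases lt_trichotomy i j with hij | rfl | hij <;> omega

/-- The hook lengths of a symbol are the absolute values of the modified hook lengths of
its balanced quotient together with the hook lengths of its core. -/
theorem hookLens_eq_abs_quotient_add_core (hcard : ∀ i, (Y i).card = r)
    (hY : ∀ i, partitionOf (Y i) = partitionOf (T i)) (c : Fin d → ℝ) (k : ℝ)
    (hlen : ∀ p : ℤ × Fin d × Fin d, IsHookPosition p → 0 ≤ positionLen c k p) :
    hookLens c k T = (hookLens (fun i => c i + k * ((T i).card : ℝ)) k Y).map (fun t => |t|) +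
      hookLens c k (coreSymbol T) := by
  classical
  set x : Fin d → ℤ := fun i => ((T i).card : ℤ) with hx
  set len := positionLen c k with hlen_def
  have hshift (p : ℤ × Fin d × Fin d) :
      positionLen (fun i => c i + k * ((T i).card : ℝ)) k p = len (shiftPosition x p) := by
    simp only [hlen_def, positionLen, shiftPosition, hx, Equiv.coe_fn_mk]
    push_cast
    ring
  have hflip (p : ℤ × Fin d × Fin d) : len (flipPosition d p) = -len p := by
    simp only [hlen_def, positionLen, flipPosition, Equiv.coe_fn_mk]
    push_cast
    ring
  -- contributions of the hooks of `Y` that stay hooks, and of those that are exchanged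
  let f (p : ℤ × Fin d × Fin d) : ℕ :=
    if IsHookPosition (shiftPosition x p) then hookCount Y p else 0
  let g (p : ℤ × Fin d × Fin d) : ℕ :=
    if IsHookPosition (flipPosition d (shiftPosition x p)) then hookCount Y p else 0
  have hsplit (p : ℤ × Fin d × Fin d) :
      hookCount Y p • ({|len (shiftPosition x p)|} : Multiset ℝ) =
        f p • {len (shiftPosition x p)} + g p • {len (flipPosition d (shiftPosition x p))} := by
    by_cases hp : IsHookPosition p
    · by_cases hq : IsHookPosition (shiftPosition x p)
      · simp only [f, g, hq, not_isHookPosition_flip hq, if_true, if_false, zero_smul, add_zero,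
          abs_of_nonneg (hlen _ hq)]
      · have hq' := (isHookPosition_or_flip (x := x) hp).resolve_left hq
        have hnn := hlen _ hq'
        simp only [f, g, hq, hq', if_true, if_false, zero_smul, zero_add]
        rw [hflip, abs_of_nonpos (by rw [hflip] at hnn; linarith)]
    · simp [f, g, hookCount, hp]
  have hfin {e : ℤ × Fin d × Fin d → ℕ} {φ : ℤ × Fin d × Fin d → ℝ} {S : Fin d → Finset ℕ}
      (h : ∀ p, hookCount S p = 0 → e p = 0) :
      Function.HasFiniteSupport fun p => e p • ({φ p} : Multiset ℝ) :=
    ((Finset.finite_toSet _).subset (support_hookCount_subset S)).subset fun p hp hp0 =>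
      hp (by simp [h p hp0])
  have hf (φ : ℤ × Fin d × Fin d → ℝ) :
      Function.HasFiniteSupport fun p => f p • ({φ p} : Multiset ℝ) :=
    hfin (S := Y) fun p hp => by simp [f, hp]
  have hg (φ : ℤ × Fin d × Fin d → ℝ) :
      Function.HasFiniteSupport fun p => g p • ({φ p} : Multiset ℝ) :=
    hfin (S := Y) fun p hp => by simp [g, hp]
  have e1 : ∑ᶠ p, f p • ({len (shiftPosition x p)} : Multiset ℝ) =
      ∑ᶠ q, f ((shiftPosition x).symm q) • ({len q} : Multiset ℝ) := by
    rw [← finsum_comp_equiv (shiftPosition x)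
      (f := fun q => f ((shiftPosition x).symm q) • ({len q} : Multiset ℝ))]
    simp only [Equiv.symm_apply_apply]
  have e2 : ∑ᶠ p, g p • ({len (flipPosition d (shiftPosition x p))} : Multiset ℝ) =
      ∑ᶠ q, g ((shiftPosition x).symm (flipPosition d q)) • ({len q} : Multiset ℝ) := by
    rw [← finsum_comp_equiv ((shiftPosition x).trans (flipPosition d)) (f := fun q =>
      g ((shiftPosition x).symm (flipPosition d q)) • ({len q} : Multiset ℝ))]
    refine finsum_congr fun p => ?_
    have : flipPosition d (flipPosition d (shiftPosition x p)) = shiftPosition x p :=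
      (flipPosition d).symm_apply_apply _
    simp only [Equiv.trans_apply, this, Equiv.symm_apply_apply]
  rw [hookLens_eq_map_positionLen, hookLens_eq_map_positionLen, hookLens_eq_map_positionLen,
    Multiset.map_map]
  simp only [Function.comp_def, hshift]
  rw [map_hookPosition_symbolHooks T len, map_hookPosition_symbolHooks (coreSymbol T) len,
    map_hookPosition_symbolHooks Y fun p => |len (shiftPosition x p)|]
  simp only [hsplit]
  have hadd (q : ℤ × Fin d × Fin d) : hookCount T q = f ((shiftPosition x).symm q) +
      g ((shiftPosition x).symm (flipPosition d q)) + hookCount (coreSymbol T) q := by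
    have : flipPosition d (flipPosition d q) = q := (flipPosition d).symm_apply_apply _
    simp only [f, g, Equiv.apply_symm_apply, this]
    exact hookCount_eq_add hcard hY q
  rw [finsum_add_distrib (hf _) (hg _), e1, e2,
    ← finsum_add_distrib (hfin (S := T) fun p hp => by have := hadd p; omega)
      (hfin (S := T) fun p hp => by have := hadd p; omega),
    ← finsum_add_distrib
      (by
        simp only [← add_smul]
        exact hfin (S := T) fun p hp => by have := hadd p; omega)
      (hfin (S := T) fun p hp => by have := hadd p; omega)]
  refine finsum_congr fun q => ?_
  rw [hadd q, add_smul, add_smul]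

end Counting

theorem lex_iff_add_mul_lt {d a b i j : ℕ} (hi : i < d) (hj : j < d) :
    (b < a ∨ (a = b ∧ j < i)) ↔ j + b * d < i + a * d := by
  rcases lt_trichotomy b a with h | rfl | h
  · have : (b + 1) * d ≤ a * d := Nat.mul_le_mul_right d h
    rw [add_one_mul] at this
    exact iff_of_true (Or.inl h) (by omega)
  · omega
  · have : (a + 1) * d ≤ b * d := Nat.mul_le_mul_right d h
    rw [add_one_mul] at this
    exact iff_of_false (by omega) (by omega)

theorem fin_add_mul_inj {d : ℕ} {i j : Fin d} {a b : ℕ}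
    (h : (i : ℕ) + a * d = j + b * d) : i = j ∧ a = b := by
  have hij : i = j := by
    have := congrArg (· % d) h
    simp only [Nat.add_mul_mod_self_right, Nat.mod_eq_of_lt (Fin.is_lt _)] at this
    exact Fin.ext this
  subst hij
  exact ⟨rfl, Nat.eq_of_mul_eq_mul_right i.pos (Nat.add_left_cancel h)⟩

theorem mem_sd {d : ℕ} {X : Finset ℕ} {i : Fin d} {k : ℕ} :
    k ∈ sd d X i ↔ (i : ℕ) + k * d ∈ X := by
  simp only [sd, Finset.mem_image, Finset.mem_filter]
  constructor
  · rintro ⟨a, ⟨ha, hai⟩, rfl⟩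
    rwa [← hai, Nat.mod_add_div']
  · intro h
    refine ⟨_, ⟨h, ?_⟩, ?_⟩
    · rw [Nat.add_mul_mod_self_right, Nat.mod_eq_of_lt i.2]
    · rw [Nat.add_mul_div_right _ _ i.pos, Nat.div_eq_of_lt i.2, zero_add]

theorem add_mul_mem_sdInv {d : ℕ} {S : Fin d → Finset ℕ} {i : Fin d} {k : ℕ} :
    (i : ℕ) + k * d ∈ sdInv d S ↔ k ∈ S i := by
  simp only [sdInv, Finset.mem_biUnion, Finset.mem_univ, true_and, Finset.mem_image]
  constructor
  · rintro ⟨j, k', hk', h⟩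
    obtain ⟨rfl, rfl⟩ := fin_add_mul_inj h
    exact hk'
  · exact fun h => ⟨i, k, h, rfl⟩

/-- `T` is the `dℓ`-symbol of the same β-set as the `d`-symbol `S`. -/
def IsRefinement {d ℓ : ℕ} (hd : 0 < d) (S : Fin d → Finset ℕ)
    (T : Fin (d * ℓ) → Finset ℕ) : Prop :=
  ∀ (i : Fin (d * ℓ)) (r : ℕ), r ∈ T i ↔ r * ℓ + (i : ℕ) / d ∈ S ⟨i % d, Nat.mod_lt _ hd⟩

theorem mod_add_mul_div_mul (d ℓ i r : ℕ) :
    i % d + (r * ℓ + i / d) * d = i + r * (d * ℓ) := by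
  conv_rhs => rw [← Nat.mod_add_div' i d]
  ring

theorem isRefinement_sd_sdInv {d ℓ : ℕ} (hd : 0 < d) (S : Fin d → Finset ℕ) :
    IsRefinement hd S (sd (d * ℓ) (sdInv d S)) := fun i r => by
  rw [mem_sd, ← mod_add_mul_div_mul]
  exact add_mul_mem_sdInv (i := ⟨i % d, Nat.mod_lt _ hd⟩)

theorem sd_sdInv_isRefinement {d ℓ : ℕ} (hd : 0 < d) (T : Fin (d * ℓ) → Finset ℕ) :
    IsRefinement hd (sd d (sdInv (d * ℓ) T)) T := fun i r => by
  rw [mem_sd, mod_add_mul_div_mul, add_mul_mem_sdInv]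

namespace IsRefinement

variable {d ℓ : ℕ} {hd : 0 < d} {S : Fin d → Finset ℕ} {T : Fin (d * ℓ) → Finset ℕ}

theorem card_eq (h : IsRefinement hd S T) (i : Fin (d * ℓ)) :
    (T i).card = ((S ⟨i % d, Nat.mod_lt _ hd⟩).filter fun a => a % ℓ = (i : ℕ) / d).card := by
  have hℓ : 0 < ℓ := Nat.pos_of_mul_pos_left i.pos
  have hi : (i : ℕ) / d < ℓ := Nat.div_lt_of_lt_mul i.2
  refine Finset.card_bij (fun r _ => r * ℓ + (i : ℕ) / d) (fun r hr => ?_)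
    (fun r _ r' _ hrr => ?_) (fun a ha => ?_)
  · rw [Finset.mem_filter, Nat.mul_add_mod_self_right, Nat.mod_eq_of_lt hi]
    exact ⟨(h i r).1 hr, rfl⟩
  · exact Nat.eq_of_mul_eq_mul_right hℓ (Nat.add_right_cancel hrr)
  · rw [Finset.mem_filter] at ha
    have ha' : a / ℓ * ℓ + (i : ℕ) / d = a := by rw [← ha.2, Nat.div_add_mod']
    exact ⟨a / ℓ, (h i _).2 (by rw [ha']; exact ha.1), ha'⟩

/-- The hook of the `d`-symbol corresponding to a hook of the `dℓ`-symbol. -/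
def unrefineHook (hd : 0 < d) (z : ℕ × ℕ × Fin (d * ℓ) × Fin (d * ℓ)) : ℕ × ℕ × Fin d × Fin d :=
  (z.1 * ℓ + (z.2.2.1 : ℕ) / d, z.2.1 * ℓ + (z.2.2.2 : ℕ) / d,
    ⟨z.2.2.1 % d, Nat.mod_lt _ hd⟩, ⟨z.2.2.2 % d, Nat.mod_lt _ hd⟩)

theorem unrefineHook_injective (hd : 0 < d) :
    Function.Injective (unrefineHook (d := d) (ℓ := ℓ) hd) := by
  rintro ⟨a, b, i, j⟩ ⟨a', b', i', j'⟩ h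
  simp only [unrefineHook, Prod.mk.injEq, Fin.mk.injEq] at h
  obtain ⟨ha, hb, hi, hj⟩ := h
  have h1 := congrArg₂ (fun u v => u + v * d) hi ha
  have h2 := congrArg₂ (fun u v => u + v * d) hj hb
  simp only [mod_add_mul_div_mul] at h1 h2
  obtain ⟨rfl, rfl⟩ := fin_add_mul_inj h1
  obtain ⟨rfl, rfl⟩ := fin_add_mul_inj h2
  rfl

theorem symbolHooks_eq_image (hℓ : 0 < ℓ) (h : IsRefinement hd S T) :
    symbolHooks S = (symbolHooks T).image (unrefineHook hd) := by
  have hmem (z : ℕ × ℕ × Fin (d * ℓ) × Fin (d * ℓ)) :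
      unrefineHook hd z ∈ symbolHooks S ↔ z ∈ symbolHooks T := by
    rw [mem_symbolHooks, mem_symbolHooks, h, h, unrefineHook, Fin.lt_def, Fin.lt_def,
      lex_iff_add_mul_lt (Nat.mod_lt _ hd) (Nat.mod_lt _ hd), lex_iff_add_mul_lt z.2.2.1.2
        z.2.2.2.2, mod_add_mul_div_mul, mod_add_mul_div_mul]
  have hsurj (u : ℕ × ℕ × Fin d × Fin d) : ∃ z, unrefineHook (ℓ := ℓ) hd z = u := by
    obtain ⟨a, b, i, j⟩ := u
    have hlt (i : Fin d) (a : ℕ) : (i : ℕ) + a % ℓ * d < d * ℓ := by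
      have := Nat.mul_le_mul_left d (Nat.mod_lt a hℓ)
      rw [Nat.mul_succ, mul_comm] at this
      omega
    refine ⟨(a / ℓ, b / ℓ, ⟨_, hlt i a⟩, ⟨_, hlt j b⟩), ?_⟩
    simp only [unrefineHook, Nat.add_mul_div_right _ _ hd, Nat.div_eq_of_lt (Fin.is_lt _),
      zero_add, Nat.div_add_mod', Nat.add_mul_mod_self_right, Nat.mod_eq_of_lt (Fin.is_lt _)]
  ext u
  rw [Finset.mem_image]
  constructor
  · intro hu
    obtain ⟨z, rfl⟩ := hsurj u
    exact ⟨z, (hmem z).1 hu, rfl⟩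
  · rintro ⟨z, hz, rfl⟩
    exact (hmem z).2 hz

theorem map_symbolHooks_eq_hookLens (hℓ : 0 < ℓ) (h : IsRefinement hd S T) :
    (symbolHooks S).val.map (fun z => ((z.1 - z.2.1 : ℕ) : ℝ)) =
      hookLens (fun i : Fin (d * ℓ) => (((i : ℕ) / d : ℕ) : ℝ)) (ℓ : ℝ) T := by
  rw [h.symbolHooks_eq_image hℓ, Finset.image_val_of_injOn (unrefineHook_injective hd).injOn,
    Multiset.map_map, hookLens]
  refine Multiset.map_congr rfl fun z hz => ?_
  have hu := mem_symbolHooks.1 (h.symbolHooks_eq_image hℓ ▸ Finset.mem_image_of_mem _ hz)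
  have hle : (unrefineHook hd z).2.1 ≤ (unrefineHook hd z).1 := by omega
  have hle' : z.2.1 ≤ z.1 := by have := mem_symbolHooks.1 hz; omega
  rw [Function.comp_apply, Nat.cast_sub hle, hookLen, Nat.cast_sub hle']
  simp only [unrefineHook]
  push_cast
  ring

end IsRefinement

theorem positionLen_div_nonneg {d ℓ : ℕ} (p : ℤ × Fin (d * ℓ) × Fin (d * ℓ))
    (hp : IsHookPosition p) :
    0 ≤ positionLen (fun i : Fin (d * ℓ) => (((i : ℕ) / d : ℕ) : ℝ)) (ℓ : ℝ) p := by
  rw [positionLen]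
  rcases hp with hp | ⟨hp, hlt⟩
  · have h1 : (1 : ℝ) ≤ p.1 := by exact_mod_cast hp
    have h2 : (((p.2.2 : ℕ) / d : ℕ) : ℝ) ≤ ℓ := by
      exact_mod_cast (Nat.div_lt_of_lt_mul p.2.2.2).le
    have h3 : (ℓ : ℝ) ≤ ℓ * p.1 := le_mul_of_one_le_right (Nat.cast_nonneg _) h1
    have h4 : (0 : ℝ) ≤ ((p.2.1 : ℕ) / d : ℕ) := Nat.cast_nonneg _
    linarith
  · have : (((p.2.2 : ℕ) / d : ℕ) : ℝ) ≤ ((p.2.1 : ℕ) / d : ℕ) := by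
      exact_mod_cast Nat.div_le_div_right hlt.le
    rw [hp, Int.cast_zero, mul_zero]
    linarith

/-- `𝓗(S) = abs(𝓗^{δ_{ℓ,S}}(Q)) ∪ 𝓗(C)`, where `C = C_{(ℓ)}(S)` is the `ℓ`-core of
`S`, `Q = Q_ℓ(S) = Q(S_{*ℓ})` its balanced `ℓ`-quotient, and `δ_{ℓ,S}` is the
`dℓ`-hook data tuple with multiplier `ℓ` whose entry in position `sd + i` is
`s + ℓ·x_{i,s}`, `x_{i,s}` being the number of elements of `X_i` congruent to `s`
modulo `ℓ`. -/
theorem hooks_eq_abs_ellQuot_add_ellCore (d : ℕ) (hd : 0 < d) (ℓ : ℕ) (hℓ : 0 < ℓ)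
    (S : Fin d → Finset ℕ) (Y : Fin (d * ℓ) → Finset ℕ)
    (hY : IsBalancedQuotient (sd (d * ℓ) (sdInv d S)) Y) :
    (symbolHooks S).val.map (fun z => ((z.1 - z.2.1 : ℕ) : ℝ)) =
      (hookLens
          (fun i' : Fin (d * ℓ) =>
            (((i' : ℕ) / d : ℕ) : ℝ) +
              (ℓ : ℝ) *
                (((S ⟨(i' : ℕ) % d, Nat.mod_lt _ hd⟩).filter
                    (fun a => a % ℓ = (i' : ℕ) / d)).card : ℝ))
          (ℓ : ℝ) Y).map (fun r => |r|) +
        (symbolHooks (sd d (sdInv (d * ℓ) (coreSymbol (sd (d * ℓ) (sdInv d S)))))).val.map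
          (fun z => ((z.1 - z.2.1 : ℕ) : ℝ)) := by
  have href := isRefinement_sd_sdInv (ℓ := ℓ) hd S
  rw [href.map_symbolHooks_eq_hookLens hℓ,
    (sd_sdInv_isRefinement hd _).map_symbolHooks_eq_hookLens hℓ,
    hookLens_eq_abs_quotient_add_core (fun i => (hY i).1) (fun i => (hY i).2) _ _
      positionLen_div_nonneg]
  simp only [href.card_eq]
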